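/- Let s ≥ 1 and let β be a (possibly empty) partition which, setting i = β₁, contains the partition (i^{s+1}, i, i−1, …, 2, 1), and set ν = β + (s^s). Then ν is covered neither by β + (s^s, 1) nor by β + (s^s) + (1). In particular, taking β = ∅, the square partition (s^s) is not covered by any partition μ with (s^s) ⊆ μ and |μ| = s² + 1. -/

import Mathlib

/-- A partition, 0-indexed: `f i` is the `(i+1)`-st part. A partition is a weakly
decreasing, eventually zero function `ℕ → ℕ`. -/
def IsPartition (f : ℕ → ℕ) : Prop := Antitone f ∧ ∃ N, f N = 0

/-- The number of (nonzero) parts of a partition. -/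
noncomputable def plen (f : ℕ → ℕ) : ℕ := sInf {n | f n = 0}

/-- The size (weight) of a partition: the sum of its parts. -/
noncomputable def psize (f : ℕ → ℕ) : ℕ := ∑ i ∈ Finset.range (plen f), f i

/-- Containment of partitions: `subP f g` means `f ⊆ g`, i.e. `f i ≤ g i` for all `i`. -/
def subP (f g : ℕ → ℕ) : Prop := ∀ i, f i ≤ g i

/-- The conjugate partition: `conjP f j = #{i : f i > j}` (0-indexed). -/
noncomputable def conjP (f : ℕ → ℕ) : ℕ → ℕ := fun j => Nat.card {i : ℕ // j < f i}

/-- The square partition `(s^s)`. -/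
def squareP (s : ℕ) : ℕ → ℕ := fun j => if j < s then s else 0

/-- The partition `(s^s, 1)`: `s` parts equal to `s` followed by a part equal to `1`. -/
def squareP1 (s : ℕ) : ℕ → ℕ := fun j => if j < s then s else if j = s then 1 else 0

/-- The complement of `f` in the square `(m^m)`: the `(i+1)`-st part (0-indexed `i < m`)
is `m - f (m - 1 - i)`. -/
def complP (m : ℕ) (f : ℕ → ℕ) : ℕ → ℕ := fun i => if i < m then m - f (m - 1 - i) else 0

/-- `ν + (1)`: add one box at the end of the first row. -/
def addRow1 (f : ℕ → ℕ) : ℕ → ℕ := fun j => if j = 0 then f 0 + 1 else f j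

/-- `(ν, 1)`: append a part equal to `1` after the last nonzero part. -/
noncomputable def addPart1 (f : ℕ → ℕ) : ℕ → ℕ :=
  fun j => if j < plen f then f j else if j = plen f then 1 else 0

/-- Delete the first `k` columns of a partition. -/
def colDel (k : ℕ) (f : ℕ → ℕ) : ℕ → ℕ := fun j => f j - k

/-- Delete the first `s` rows of a partition. -/
def rowDel (s : ℕ) (f : ℕ → ℕ) : ℕ → ℕ := fun j => f (j + s)

/-- The sequence whose first `m` entries are given by `f` and whose subsequent entries
are given by `g`; used to form `(η^{c,m} + γ, σ)`. -/
def appendAfter (m : ℕ) (f g : ℕ → ℕ) : ℕ → ℕ := fun i => if i < m then f i else g (i - m)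

/-- The cell in row `r`, column `c` (both 0-indexed) belongs to the skew diagram
`lam/alpha`. -/
def inShape (lam alpha : ℕ → ℕ) (r c : ℕ) : Prop := alpha r ≤ c ∧ c < lam r

/-- A Littlewood–Richardson tableau of shape `lam/alpha` and content `beta`
(for each `k`, there are `beta k` entries equal to `k + 1`): a semistandard filling of
the skew diagram whose reverse reading word is a lattice permutation.  The lattice
condition is expressed by comparing, in every prefix of the reverse reading word ending
at a cell `(r, c)` (all cells in rows above `r`, together with the cells in row `r`
weakly to the right of column `c`), the number of entries `k + 2` with the number of
entries `k + 1`. -/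
structure LRTableau (lam alpha beta : ℕ → ℕ) where
  entry : ℕ → ℕ → ℕ
  zero_outside : ∀ r c, ¬ inShape lam alpha r c → entry r c = 0
  one_le : ∀ r c, inShape lam alpha r c → 1 ≤ entry r c
  row_weak : ∀ r c₁ c₂, c₁ ≤ c₂ → inShape lam alpha r c₁ → inShape lam alpha r c₂ →
    entry r c₁ ≤ entry r c₂
  col_strict : ∀ r₁ r₂ c, r₁ < r₂ → inShape lam alpha r₁ c → inShape lam alpha r₂ c →
    entry r₁ c < entry r₂ c
  content : ∀ k : ℕ,
    Nat.card {p : ℕ × ℕ // inShape lam alpha p.1 p.2 ∧ entry p.1 p.2 = k + 1} = beta k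
  lattice : ∀ r c k : ℕ, inShape lam alpha r c →
    Nat.card {p : ℕ × ℕ // inShape lam alpha p.1 p.2 ∧
        (p.1 < r ∨ (p.1 = r ∧ c ≤ p.2)) ∧ entry p.1 p.2 = k + 2} ≤
    Nat.card {p : ℕ × ℕ // inShape lam alpha p.1 p.2 ∧
        (p.1 < r ∨ (p.1 = r ∧ c ≤ p.2)) ∧ entry p.1 p.2 = k + 1}

open Classical in
/-- The Littlewood–Richardson coefficient `c^lam_{alpha, beta}`: the number of LR
tableaux of shape `lam/alpha` and content `beta`, or `0` if `alpha ⊄ lam`. -/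
noncomputable def LRcoeff (lam alpha beta : ℕ → ℕ) : ℕ :=
  if subP alpha lam then Nat.card (LRTableau lam alpha beta) else 0

/-- `mu` covers `nu`: for every integer `m ≥ μ₁ + ℓ(μ)` and every partition `lam`,
`c^lam_{ν^{c,m}, ν'} ≤ c^lam_{μ^{c,m}, μ'}`, i.e. `s_{μ'} s_{μ^c} - s_{ν'} s_{ν^c}`
is Schur-positive (complements taken in `(m^m)`). -/
def Covers (mu nu : ℕ → ℕ) : Prop :=
  ∀ m : ℕ, mu 0 + plen mu ≤ m → ∀ lam : ℕ → ℕ, IsPartition lam →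
    LRcoeff lam (complP m nu) (conjP nu) ≤ LRcoeff lam (complP m mu) (conjP mu)

/-- The partition `(i^{s+1}, i, i-1, ..., 2, 1)` (as a 0-indexed function). -/
def betaShape (i s : ℕ) : ℕ → ℕ := fun j => if j ≤ s + 1 then i else i + s + 1 - j

/-- A partition is of type 1 if it contains `(i, i, i-1, ..., 2, 1)` where `i` is its
first part. -/
def Type1 (nu : ℕ → ℕ) : Prop := IsPartition nu ∧ subP (betaShape (nu 0) 0) nu

/-- `nu = beta + (s^s) + alpha` (componentwise) is a type-2 decomposition: `s ≥ 1`,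
`alpha` is a nonempty partition with at most `s` parts, and `beta` is a (possibly empty)
partition containing `(i^{s+1}, i, i-1, ..., 2, 1)` where `i = beta 0`. -/
def IsType2Decomp (nu beta : ℕ → ℕ) (s : ℕ) (alpha : ℕ → ℕ) : Prop :=
  IsPartition beta ∧ IsPartition alpha ∧ 1 ≤ s ∧ alpha 0 ≠ 0 ∧ plen alpha ≤ s ∧
    subP (betaShape (beta 0) s) beta ∧ ∀ j, nu j = beta j + squareP s j + alpha j

/-- A partition is of type 2 if it admits a type-2 decomposition. -/
def Type2 (nu : ℕ → ℕ) : Prop := ∃ beta s alpha, IsType2Decomp nu beta s alpha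

/-- A self-conjugate partition. -/
def SelfConjugate (t : ℕ → ℕ) : Prop := ∀ j, conjP t j = t j

/-- A partition `nu` is corner-symmetric if for every outer corner of `nu` in row
`r + 1 ≥ 2` (1-indexed), i.e. every 0-indexed row `r ≥ 1` with `nu r < nu (r-1)`
(the corner cell lying in 0-indexed column `nu r`), there is a nonempty partition
`η ⊆ nu` such that the skew diagram `nu/η` is, up to translation, the Young diagram of
a self-conjugate partition, contains the cell `(r-1, nu r)` (0-indexed), and contains
no cell in any column of 0-indexed column index `< nu r`. -/
def CornerSymmetric (nu : ℕ → ℕ) : Prop :=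
  ∀ r : ℕ, 1 ≤ r → nu r < nu (r - 1) →
    ∃ η : ℕ → ℕ, IsPartition η ∧ subP η nu ∧ η 0 ≠ 0 ∧
      ∃ t : ℕ → ℕ, ∃ r0 c0 : ℕ, IsPartition t ∧ SelfConjugate t ∧
        (∀ a b : ℕ, (η a ≤ b ∧ b < nu a) ↔ (r0 ≤ a ∧ c0 ≤ b ∧ b - c0 < t (a - r0))) ∧
        η (r - 1) ≤ nu r ∧
        (∀ a b : ℕ, η a ≤ b → b < nu a → nu r ≤ b)

theorem conjP_eq_of_lt_iff {f : ℕ → ℕ} {j n : ℕ} (h : ∀ r, j < f r ↔ r < n) :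
    conjP f j = n := by
  have : Nat.card {i : ℕ // j < f i} = (Finset.range n).card :=
    Nat.subtype_card _ fun r => by simp [h]
  simpa [conjP] using this

theorem lt_conjP_iff {f : ℕ → ℕ} (hf : IsPartition f) (r j : ℕ) :
    r < conjP f j ↔ j < f r := by
  classical
  obtain ⟨hanti, N, hN⟩ := hf
  have hex : ∃ n, f n ≤ j := ⟨N, by omega⟩
  have key : ∀ r, j < f r ↔ r < Nat.find hex := by
    intro r
    rw [Nat.lt_find_iff]
    constructor
    · intro h n hn
      have := hanti hn
      omega
    · intro h
      have := h r le_rfl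
      omega
  rw [conjP_eq_of_lt_iff key, key]

theorem isPartition_apply_plen {f : ℕ → ℕ} (hf : IsPartition f) : f (plen f) = 0 :=
  Nat.sInf_mem (s := {n | f n = 0}) hf.2

theorem finite_inShape {lam : ℕ → ℕ} (hlam : IsPartition lam) (alpha : ℕ → ℕ) :
    {p : ℕ × ℕ | inShape lam alpha p.1 p.2}.Finite := by
  obtain ⟨hanti, N, hN⟩ := hlam
  refine ((Finset.range N ×ˢ Finset.range (lam 0)).finite_toSet).subset ?_
  rintro ⟨r, c⟩ ⟨-, h⟩
  have h0 : lam r ≤ lam 0 := hanti (Nat.zero_le r)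
  have h1 : r < N := by
    by_contra! hr
    have := hanti hr
    simp only at h
    omega
  simp only at h
  simp only [Finset.coe_product, Finset.coe_range, Set.mem_prod, Set.mem_Iio]
  omega

namespace LRTableau

variable {lam alpha beta : ℕ → ℕ}

/-- The number of entries equal to `v` in the first `R` rows of a tableau. -/
noncomputable def countRows (T : LRTableau lam alpha beta) (v R : ℕ) : ℕ :=
  Nat.card {p : ℕ × ℕ // inShape lam alpha p.1 p.2 ∧ p.1 < R ∧ T.entry p.1 p.2 = v}

theorem countRows_le_of_imp (hlam : IsPartition lam) (T : LRTableau lam alpha beta)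
    {v : ℕ} {R : ℕ} {P : ℕ × ℕ → Prop}
    (h : ∀ p : ℕ × ℕ, inShape lam alpha p.1 p.2 → P p → p.1 < R ∧ T.entry p.1 p.2 = v) :
    Nat.card {p : ℕ × ℕ // inShape lam alpha p.1 p.2 ∧ P p} ≤ T.countRows v R :=
  Nat.card_mono (s := {p : ℕ × ℕ | inShape lam alpha p.1 p.2 ∧ P p})
    ((finite_inShape hlam alpha).subset fun _ hp => hp.1)
    fun p hp => ⟨hp.1, h p hp.1 hp.2⟩

theorem countRows_succ_le_of_exists (hlam : IsPartition lam) (T : LRTableau lam alpha beta)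
    {k R : ℕ} (hex : ∃ c, inShape lam alpha R c ∧ T.entry R c = k + 2) :
    T.countRows (k + 2) (R + 1) ≤ T.countRows (k + 1) R := by
  classical
  obtain ⟨hs, he⟩ := Nat.find_spec hex
  set c := Nat.find hex with hc
  refine le_trans ?_ ((T.lattice R c k hs).trans (T.countRows_le_of_imp hlam ?_))
  · refine Nat.card_mono (s := {p : ℕ × ℕ | inShape lam alpha p.1 p.2 ∧ p.1 < R + 1 ∧
        T.entry p.1 p.2 = k + 2}) (t := {p : ℕ × ℕ | inShape lam alpha p.1 p.2 ∧
        (p.1 < R ∨ (p.1 = R ∧ c ≤ p.2)) ∧ T.entry p.1 p.2 = k + 2})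
      ((finite_inShape hlam alpha).subset fun _ hp => hp.1) ?_
    rintro ⟨r, d⟩ ⟨hrs, hr, hre⟩
    refine ⟨hrs, ?_, hre⟩
    rcases Nat.lt_succ_iff_lt_or_eq.mp hr with h | h
    · exact Or.inl h
    · simp only at h hrs hre
      subst h
      exact Or.inr ⟨rfl, Nat.find_min' hex ⟨hrs, hre⟩⟩
  · rintro ⟨r, d⟩ hrs ⟨hr, hre⟩
    refine ⟨hr.resolve_right ?_, hre⟩
    rintro ⟨h, hcd⟩
    simp only at h hrs hre hcd
    subst h
    have := T.row_weak r c d hcd hs hrs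
    omega

/-- In an LR tableau every entry `k + 2` is preceded, in strictly higher rows, by enough
entries `k + 1`. -/
theorem countRows_succ_le (hlam : IsPartition lam) (T : LRTableau lam alpha beta)
    (k R : ℕ) : T.countRows (k + 2) (R + 1) ≤ T.countRows (k + 1) R := by
  induction R with
  | zero =>
    by_cases hex : ∃ c, inShape lam alpha 0 c ∧ T.entry 0 c = k + 2
    · exact T.countRows_succ_le_of_exists hlam hex
    · refine T.countRows_le_of_imp hlam ?_
      rintro ⟨r, c⟩ hs ⟨hr, he⟩
      obtain rfl : r = 0 := by simpa using hr
      exact absurd ⟨c, hs, he⟩ hex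
  | succ R ih =>
    by_cases hex : ∃ c, inShape lam alpha (R + 1) c ∧ T.entry (R + 1) c = k + 2
    · exact T.countRows_succ_le_of_exists hlam hex
    · calc T.countRows (k + 2) (R + 1 + 1) ≤ T.countRows (k + 2) (R + 1) := by
            refine T.countRows_le_of_imp hlam ?_
            rintro ⟨r, c⟩ hs ⟨hr, he⟩
            refine ⟨lt_of_le_of_ne (Nat.lt_succ_iff.mp hr) ?_, he⟩
            rintro rfl
            exact hex ⟨c, hs, he⟩
        _ ≤ T.countRows (k + 1) R := ih
        _ ≤ T.countRows (k + 1) (R + 1) :=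
            T.countRows_le_of_imp hlam fun p _ hp => ⟨hp.1.trans (Nat.lt_succ_self R), hp.2⟩

theorem countRows_add_le (hlam : IsPartition lam) (T : LRTableau lam alpha beta)
    (k R n : ℕ) : T.countRows (k + 1 + n) (R + n) ≤ T.countRows (k + 1) R := by
  induction n with
  | zero => exact le_rfl
  | succ n ih =>
    have h := T.countRows_succ_le hlam (k + n) (R + n)
    rw [show k + n + 2 = k + 1 + (n + 1) by omega, show k + n + 1 = k + 1 + n by omega] at h
    exact h.trans ih

theorem content_le_countRows (hlam : IsPartition lam) (T : LRTableau lam alpha beta)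
    {R : ℕ} (hR : lam R = 0) (k : ℕ) : beta k ≤ T.countRows (k + 1) R := by
  rw [← T.content k]
  refine T.countRows_le_of_imp hlam fun p hp he => ⟨?_, he⟩
  by_contra! hr
  have h1 := hlam.1 hr
  have h2 := hp.2
  omega

theorem finite (hlam : IsPartition lam) {K : ℕ} (hK : ∀ k, K ≤ k → beta k = 0) :
    Finite (LRTableau lam alpha beta) := by
  have hbound : ∀ (T : LRTableau lam alpha beta) r c, T.entry r c < K + 1 := by
    intro T r c
    by_contra! h
    by_cases hs : inShape lam alpha r c
    · have h0 := T.content (T.entry r c - 1)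
      rw [hK _ (by omega)] at h0
      have : Finite {p : ℕ × ℕ // inShape lam alpha p.1 p.2 ∧
          T.entry p.1 p.2 = T.entry r c - 1 + 1} :=
        ((finite_inShape hlam alpha).subset fun _ hp => hp.1 :
          {p : ℕ × ℕ | inShape lam alpha p.1 p.2 ∧
            T.entry p.1 p.2 = T.entry r c - 1 + 1}.Finite)
      exact (Finite.card_eq_zero_iff.mp h0).false ⟨(r, c), hs, by simp only; omega⟩
    · rw [T.zero_outside r c hs] at h
      omega
  have := (finite_inShape hlam alpha).to_subtype
  refine Finite.of_injective
    (fun (T : LRTableau lam alpha beta) (p : {p : ℕ × ℕ | inShape lam alpha p.1 p.2}) =>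
      (⟨T.entry p.1.1 p.1.2, hbound T _ _⟩ : Fin (K + 1))) ?_
  intro T U hTU
  have hentry : T.entry = U.entry := by
    funext r c
    by_cases hs : inShape lam alpha r c
    · exact congrArg Fin.val (congrFun hTU ⟨(r, c), hs⟩)
    · rw [T.zero_outside r c hs, U.zero_outside r c hs]
  cases T
  cases U
  simpa using hentry

end LRTableau

/-- The partition `(β^{c,m}, β')`. -/
noncomputable def complConj (m : ℕ) (beta : ℕ → ℕ) : ℕ → ℕ :=
  appendAfter m (complP m beta) (conjP beta)

theorem complConj_of_lt {m r : ℕ} (beta : ℕ → ℕ) (h : r < m) :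
    complConj m beta r = m - beta (m - 1 - r) := by
  simp [complConj, appendAfter, complP, h]

theorem complConj_of_le {m r : ℕ} (beta : ℕ → ℕ) (h : m ≤ r) :
    complConj m beta r = conjP beta (r - m) := by
  simp [complConj, appendAfter, Nat.not_lt.mpr h]

theorem conjP_antitone {f : ℕ → ℕ} (hf : IsPartition f) : Antitone (conjP f) := by
  intro a b hab
  by_contra! h
  have h1 := (lt_conjP_iff hf _ _).mp h
  have h2 := (lt_conjP_iff hf (conjP f a) a).mpr (by omega)
  omega

theorem conjP_eq_zero {f : ℕ → ℕ} (hf : IsPartition f) {j : ℕ} (hj : f 0 ≤ j) :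
    conjP f j = 0 := by
  by_contra h
  have := (lt_conjP_iff hf 0 j).mp (by omega)
  omega

theorem conjP_le {f : ℕ → ℕ} (hf : IsPartition f) {L : ℕ} (hL : f L = 0) (j : ℕ) :
    conjP f j ≤ L := by
  by_contra! h
  have := (lt_conjP_iff hf L j).mp h
  omega

theorem isPartition_complConj {m L : ℕ} {beta : ℕ → ℕ} (hbeta : IsPartition beta)
    (hL : beta L = 0) (hm : beta 0 + L ≤ m) : IsPartition (complConj m beta) := by
  refine ⟨?_, m + beta 0, ?_⟩
  · intro a b hab
    rcases lt_or_ge b m with hb | hb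
    · rw [complConj_of_lt _ hb, complConj_of_lt _ (by omega)]
      have := hbeta.1 (show m - 1 - b ≤ m - 1 - a by omega)
      omega
    · rw [complConj_of_le _ hb]
      rcases lt_or_ge a m with ha | ha
      · rw [complConj_of_lt _ ha]
        have h1 := hbeta.1 (Nat.zero_le (m - 1 - a))
        have h2 := conjP_le hbeta hL (b - m)
        omega
      · rw [complConj_of_le _ ha]
        exact conjP_antitone hbeta (by omega)
  · rw [complConj_of_le _ (by omega)]
    exact conjP_eq_zero hbeta (by omega)

theorem complConj_apply_add {m : ℕ} {beta : ℕ → ℕ} (hbeta : IsPartition beta) :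
    complConj m beta (m + beta 0) = 0 := by
  rw [complConj_of_le _ (by omega)]
  exact conjP_eq_zero hbeta (by omega)

/-- The starting column of the strip of `s` cells in row `r` of the skew shape
`(β^{c,m}, β') / (β + (s^s))^{c,m}`. -/
noncomputable def stripStart (m s : ℕ) (beta : ℕ → ℕ) (r : ℕ) : ℕ :=
  if r < m then m - beta 0 - s else conjP beta (r - m) - s

/-- The cells of `(β^{c,m}, β') / (β + (s^s))^{c,m}` lying to the left of the strips. -/
def IsLowCell (m s : ℕ) (beta : ℕ → ℕ) (r c : ℕ) : Prop :=
  m ≤ r ∧ r < m + beta 0 ∧ c < conjP beta (r - m) - s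

/-- The cells of `(β^{c,m}, β') / (β + (s^s))^{c,m}` lying in the strips. -/
def IsStripCell (m s : ℕ) (beta : ℕ → ℕ) (r c : ℕ) : Prop :=
  m - s ≤ r ∧ r < m + beta 0 ∧ stripStart m s beta r ≤ c ∧ c < stripStart m s beta r + s

open Classical in
/-- The entries of the LR tableau of shape `(β^{c,m}, β') / (β + (s^s))^{c,m}` and content
conjugate to `β + (s^s)`. -/
noncomputable def squareEntry (m s : ℕ) (beta : ℕ → ℕ) (r c : ℕ) : ℕ :=
  if IsLowCell m s beta r c then r - m + 1
  else if IsStripCell m s beta r c then r - (m - s) + 1 else 0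

section Square

variable {m s L : ℕ} {beta : ℕ → ℕ}

theorem add_lt_conjP (hbeta : IsPartition beta) (hrect : beta s = beta 0) {j : ℕ}
    (hj : j < beta 0) : s < conjP beta j :=
  (lt_conjP_iff hbeta _ _).mpr (by omega)

theorem apply_eq_of_le (hbeta : IsPartition beta) (hrect : beta s = beta 0) {j : ℕ}
    (hj : j ≤ s) : beta j = beta 0 := by
  have h1 := hbeta.1 hj
  have h2 := hbeta.1 (Nat.zero_le j)
  omega

theorem inShape_square_iff (hbeta : IsPartition beta) (hrect : beta s = beta 0)
    (hm : beta 0 + s + L ≤ m) (r c : ℕ) :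
    inShape (complConj m beta) (complP m fun j => beta j + squareP s j) r c ↔
      IsLowCell m s beta r c ∨ IsStripCell m s beta r c := by
  unfold inShape IsLowCell IsStripCell stripStart
  rcases lt_or_ge r m with hr | hr
  · rw [complConj_of_lt _ hr]
    simp only [complP, squareP, if_pos hr]
    by_cases hrs : m - s ≤ r
    · rw [apply_eq_of_le hbeta hrect (show m - 1 - r ≤ s by omega), if_pos (by omega)]
      omega
    · rw [if_neg (by omega)]
      omega
  · rw [complConj_of_le _ hr]
    simp only [complP, if_neg (Nat.not_lt.mpr hr)]
    by_cases hri : r < m + beta 0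
    · have := add_lt_conjP hbeta hrect (show r - m < beta 0 by omega)
      omega
    · have := conjP_eq_zero hbeta (show beta 0 ≤ r - m by omega)
      omega

theorem squareEntry_of_low {r c : ℕ} (h : IsLowCell m s beta r c) :
    squareEntry m s beta r c = r - m + 1 := by
  simp [squareEntry, h]

theorem not_low_of_strip {r c : ℕ} (h : IsStripCell m s beta r c) :
    ¬ IsLowCell m s beta r c := by
  rintro ⟨h1, -, h2⟩
  obtain ⟨-, -, h3, -⟩ := h
  rw [stripStart, if_neg (by omega)] at h3
  omega

theorem squareEntry_of_strip {r c : ℕ} (h : IsStripCell m s beta r c) :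
    squareEntry m s beta r c = r - (m - s) + 1 := by
  simp [squareEntry, h, not_low_of_strip h]

theorem conjP_add_square (hbeta : IsPartition beta) (hrect : beta s = beta 0) (k : ℕ) :
    conjP (fun j => beta j + squareP s j) k =
      (conjP beta k - s) + if k < beta 0 + s then s else 0 := by
  refine conjP_eq_of_lt_iff fun r => ?_
  have h0 := lt_conjP_iff hbeta r k
  have h1 := hbeta.1 (Nat.zero_le r)
  have h2 := fun h : r ≤ s => apply_eq_of_le hbeta hrect h
  rcases lt_or_ge k (beta 0) with hk | hk
  · have h3 := add_lt_conjP hbeta hrect hk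
    rw [if_pos (by omega)]
    simp only [squareP]
    split_ifs <;> omega
  · have h3 := conjP_eq_zero hbeta hk
    simp only [squareP]
    split_ifs <;> omega

theorem card_squareEntry (hbeta : IsPartition beta) (hrect : beta s = beta 0)
    (hm : beta 0 + s + L ≤ m) (k : ℕ) :
    Nat.card {p : ℕ × ℕ //
      inShape (complConj m beta) (complP m fun j => beta j + squareP s j) p.1 p.2 ∧
        squareEntry m s beta p.1 p.2 = k + 1} =
      conjP (fun j => beta j + squareP s j) k := by
  classical
  set low : Finset (ℕ × ℕ) := {m + k} ×ˢ Finset.range (conjP beta k - s) with hlow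
  set strip : Finset (ℕ × ℕ) :=
    if k < beta 0 + s then
      {m - s + k} ×ˢ Finset.Ico (stripStart m s beta (m - s + k))
        (stripStart m s beta (m - s + k) + s)
    else ∅ with hstrip
  have mem_low : ∀ r c, (r, c) ∈ low ↔ IsLowCell m s beta r c ∧ r - m + 1 = k + 1 := by
    intro r c
    simp only [hlow, Finset.mem_product, Finset.mem_singleton, Finset.mem_range, IsLowCell]
    constructor
    · rintro ⟨rfl, hc⟩
      have : k < beta 0 := by
        by_contra! hk
        rw [conjP_eq_zero hbeta hk] at hc
        omega
      rw [Nat.add_sub_cancel_left]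
      omega
    · rintro ⟨⟨h1, h2, h3⟩, h4⟩
      obtain rfl : k = r - m := by omega
      exact ⟨by omega, h3⟩
  have mem_strip : ∀ r c,
      (r, c) ∈ strip ↔ IsStripCell m s beta r c ∧ r - (m - s) + 1 = k + 1 := by
    intro r c
    simp only [hstrip, IsStripCell]
    split_ifs with hk
    · simp only [Finset.mem_product, Finset.mem_singleton, Finset.mem_Ico]
      constructor
      · rintro ⟨rfl, hc⟩
        omega
      · rintro ⟨⟨h1, h2, h3⟩, h4⟩
        obtain rfl : k = r - (m - s) := by omega
        rw [Nat.add_sub_cancel' h1]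
        exact ⟨rfl, h3⟩
    · simp only [Finset.notMem_empty, false_iff]
      omega
  have hdisj : Disjoint low strip := by
    rw [Finset.disjoint_left]
    rintro ⟨r, c⟩ h1 h2
    obtain ⟨h1, h1'⟩ := (mem_low r c).mp h1
    obtain ⟨h2, h2'⟩ := (mem_strip r c).mp h2
    exact not_low_of_strip h2 h1
  rw [Nat.subtype_card (low ∪ strip), Finset.card_union_of_disjoint hdisj,
    conjP_add_square hbeta hrect]
  · congr 1
    · simp [hlow]
    · simp only [hstrip]
      split_ifs <;> simp
  · rintro ⟨r, c⟩
    rw [Finset.mem_union, mem_low, mem_strip]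
    simp only
    rw [inShape_square_iff hbeta hrect hm]
    constructor
    · rintro (⟨h, h'⟩ | ⟨h, h'⟩)
      · exact ⟨Or.inl h, (squareEntry_of_low h).trans h'⟩
      · exact ⟨Or.inr h, (squareEntry_of_strip h).trans h'⟩
    · rintro ⟨h | h, h'⟩
      · exact Or.inl ⟨h, (squareEntry_of_low h).symm.trans h'⟩
      · exact Or.inr ⟨h, (squareEntry_of_strip h).symm.trans h'⟩

open Classical in
/-- The cell containing the entry `k + 1` matched with a cell containing the entry `k + 2`
in the lattice condition. -/
noncomputable def matchCell (m s : ℕ) (beta : ℕ → ℕ) (p : ℕ × ℕ) : ℕ × ℕ :=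
  if IsLowCell m s beta p.1 p.2 then (p.1 - 1, p.2)
  else (p.1 - 1, p.2 - stripStart m s beta p.1 + stripStart m s beta (p.1 - 1))

theorem matchCell_of_low {r c : ℕ} (h : IsLowCell m s beta r c) :
    matchCell m s beta (r, c) = (r - 1, c) := by
  simp [matchCell, h]

theorem matchCell_of_strip {r c : ℕ} (h : IsStripCell m s beta r c) :
    matchCell m s beta (r, c) =
      (r - 1, c - stripStart m s beta r + stripStart m s beta (r - 1)) := by
  simp [matchCell, not_low_of_strip h]

theorem low_pred (hbeta : IsPartition beta) {r c k : ℕ} (h : IsLowCell m s beta r c)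
    (hk : r - m + 1 = k + 2) :
    IsLowCell m s beta (r - 1) c ∧ r - 1 - m + 1 = k + 1 := by
  obtain ⟨h1, h2, h3⟩ := h
  have := conjP_antitone hbeta (show r - 1 - m ≤ r - m by omega)
  exact ⟨⟨by omega, by omega, by omega⟩, by omega⟩

theorem strip_pred {r c k : ℕ} (h : IsStripCell m s beta r c)
    (hk : r - (m - s) + 1 = k + 2) :
    IsStripCell m s beta (r - 1)
        (c - stripStart m s beta r + stripStart m s beta (r - 1)) ∧
      r - 1 - (m - s) + 1 = k + 1 := by
  obtain ⟨h1, h2, h3, h4⟩ := h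
  exact ⟨⟨by omega, by omega, by omega, by omega⟩, by omega⟩

/-- The LR tableau of shape `(β^{c,m}, β') / (β + (s^s))^{c,m}` and content
conjugate to `β + (s^s)`. -/
noncomputable def squareTableau (hbeta : IsPartition beta) (hrect : beta s = beta 0)
    (hL : beta L = 0) (hm : beta 0 + s + L ≤ m) :
    LRTableau (complConj m beta) (complP m fun j => beta j + squareP s j)
      (conjP fun j => beta j + squareP s j) where
  entry := squareEntry m s beta
  zero_outside r c h := by
    rw [inShape_square_iff hbeta hrect hm, not_or] at h
    simp [squareEntry, h.1, h.2]
  one_le r c h := by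
    rcases (inShape_square_iff hbeta hrect hm r c).mp h with h | h
    · rw [squareEntry_of_low h]
      omega
    · rw [squareEntry_of_strip h]
      omega
  row_weak r c₁ c₂ hc h₁ h₂ := by
    rcases (inShape_square_iff hbeta hrect hm r c₁).mp h₁ with h₁ | h₁ <;>
    rcases (inShape_square_iff hbeta hrect hm r c₂).mp h₂ with h₂ | h₂
    · rw [squareEntry_of_low h₁, squareEntry_of_low h₂]
    · rw [squareEntry_of_low h₁, squareEntry_of_strip h₂]
      omega
    · exact absurd ⟨h₂.1, h₂.2.1, hc.trans_lt h₂.2.2⟩ (not_low_of_strip h₁)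
    · rw [squareEntry_of_strip h₁, squareEntry_of_strip h₂]
  col_strict r₁ r₂ c hr h₁ h₂ := by
    rcases (inShape_square_iff hbeta hrect hm r₁ c).mp h₁ with h₁ | h₁ <;>
    rcases (inShape_square_iff hbeta hrect hm r₂ c).mp h₂ with h₂ | h₂
    · rw [squareEntry_of_low h₁, squareEntry_of_low h₂]
      have := h₁.1
      omega
    · rw [squareEntry_of_low h₁, squareEntry_of_strip h₂]
      have := h₁.1
      omega
    · exfalso
      rcases lt_or_ge r₁ m with hr₁ | hr₁
      · have h3 := h₁.2.2.1
        have h4 := h₂.2.2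
        have h5 := conjP_le hbeta hL (r₂ - m)
        rw [stripStart, if_pos hr₁] at h3
        omega
      · have h3 := conjP_antitone hbeta (show r₁ - m ≤ r₂ - m by omega)
        refine not_low_of_strip h₁ ⟨hr₁, h₁.2.1, ?_⟩
        have := h₂.2.2
        omega
    · rw [squareEntry_of_strip h₁, squareEntry_of_strip h₂]
      have := h₁.1
      omega
  content := card_squareEntry hbeta hrect hm
  lattice r c k _ := by
    have hlam : IsPartition (complConj m beta) :=
      isPartition_complConj hbeta hL (by omega)
    have : Finite {p : ℕ × ℕ //
        inShape (complConj m beta) (complP m fun j => beta j + squareP s j) p.1 p.2 ∧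
        (p.1 < r ∨ (p.1 = r ∧ c ≤ p.2)) ∧ squareEntry m s beta p.1 p.2 = k + 1} :=
      ((finite_inShape hlam _).subset fun _ hp => hp.1 : {p : ℕ × ℕ |
        inShape (complConj m beta) (complP m fun j => beta j + squareP s j) p.1 p.2 ∧
        (p.1 < r ∨ (p.1 = r ∧ c ≤ p.2)) ∧ squareEntry m s beta p.1 p.2 = k + 1}.Finite)
    have hmaps : ∀ p : ℕ × ℕ,
        inShape (complConj m beta) (complP m fun j => beta j + squareP s j) p.1 p.2 ∧
        (p.1 < r ∨ (p.1 = r ∧ c ≤ p.2)) ∧ squareEntry m s beta p.1 p.2 = k + 2 →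
        inShape (complConj m beta) (complP m fun j => beta j + squareP s j)
          (matchCell m s beta p).1 (matchCell m s beta p).2 ∧
        ((matchCell m s beta p).1 < r ∨
          ((matchCell m s beta p).1 = r ∧ c ≤ (matchCell m s beta p).2)) ∧
        squareEntry m s beta (matchCell m s beta p).1 (matchCell m s beta p).2 = k + 1 := by
      rintro ⟨a, d⟩ ⟨hs, hr, he⟩
      simp only at hs hr he
      rcases (inShape_square_iff hbeta hrect hm a d).mp hs with h | h
      · rw [squareEntry_of_low h] at he
        obtain ⟨h1, h2⟩ := low_pred hbeta h he
        rw [matchCell_of_low h]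
        exact ⟨(inShape_square_iff hbeta hrect hm _ _).mpr (Or.inl h1), Or.inl (by omega),
          (squareEntry_of_low h1).trans h2⟩
      · rw [squareEntry_of_strip h] at he
        obtain ⟨h1, h2⟩ := strip_pred h he
        rw [matchCell_of_strip h]
        exact ⟨(inShape_square_iff hbeta hrect hm _ _).mpr (Or.inr h1), Or.inl (by omega),
          (squareEntry_of_strip h1).trans h2⟩
    refine Nat.card_le_card_of_injective (fun p => ⟨matchCell m s beta p.1, hmaps p.1 p.2⟩) ?_
    rintro ⟨⟨a, d⟩, hs, _, he⟩ ⟨⟨a', d'⟩, hs', _, he'⟩ hmatch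
    have heq : matchCell m s beta (a, d) = matchCell m s beta (a', d') :=
      congrArg Subtype.val hmatch
    simp only at hs he hs' he'
    have hgoal : a = a' ∧ d = d' := by
      rcases (inShape_square_iff hbeta hrect hm a d).mp hs with h | h <;>
      rcases (inShape_square_iff hbeta hrect hm a' d').mp hs' with h' | h'
      · rw [matchCell_of_low h, matchCell_of_low h', Prod.mk.injEq] at heq
        have h1 := h.1
        have h2 := h'.1
        rw [squareEntry_of_low h] at he
        rw [squareEntry_of_low h'] at he'
        omega
      · rw [squareEntry_of_low h] at he
        rw [squareEntry_of_strip h'] at he'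
        have h1 := (low_pred hbeta h he).1
        have h2 := (strip_pred h' he').1
        rw [matchCell_of_low h, matchCell_of_strip h', Prod.mk.injEq] at heq
        rw [heq.1, heq.2] at h1
        exact absurd h1 (not_low_of_strip h2)
      · rw [squareEntry_of_strip h] at he
        rw [squareEntry_of_low h'] at he'
        have h1 := (strip_pred h he).1
        have h2 := (low_pred hbeta h' he').1
        rw [matchCell_of_strip h, matchCell_of_low h', Prod.mk.injEq] at heq
        rw [← heq.1, ← heq.2] at h2
        exact absurd h2 (not_low_of_strip h1)
      · rw [squareEntry_of_strip h] at he
        rw [squareEntry_of_strip h'] at he'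
        have h1 := h.1
        have h2 := h'.1
        obtain rfl : a = a' := by omega
        rw [matchCell_of_strip h, matchCell_of_strip h', Prod.mk.injEq] at heq
        have h3 := h.2.2.1
        have h4 := h'.2.2.1
        omega
    obtain ⟨rfl, rfl⟩ := hgoal
    rfl

theorem LRcoeff_square_pos (hbeta : IsPartition beta) (hrect : beta s = beta 0)
    (hL : beta L = 0) (hm : beta 0 + s + L ≤ m) :
    0 < LRcoeff (complConj m beta) (complP m fun j => beta j + squareP s j)
      (conjP fun j => beta j + squareP s j) := by
  have hsub : subP (complP m fun j => beta j + squareP s j) (complConj m beta) := by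
    intro r
    rcases lt_or_ge r m with hr | hr
    · rw [complConj_of_lt _ hr]
      simp only [complP, if_pos hr]
      omega
    · simp [complP, Nat.not_lt.mpr hr]
  rw [LRcoeff, if_pos hsub]
  have hfin : Finite (LRTableau (complConj m beta) (complP m fun j => beta j + squareP s j)
      (conjP fun j => beta j + squareP s j)) := by
    refine LRTableau.finite (K := beta 0 + s)
      (isPartition_complConj hbeta hL (by omega)) fun k hk => ?_
    rw [conjP_add_square hbeta hrect, conjP_eq_zero hbeta (by omega), if_neg (by omega),
      Nat.zero_sub]
  have : Nonempty (LRTableau (complConj m beta) (complP m fun j => beta j + squareP s j)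
      (conjP fun j => beta j + squareP s j)) := ⟨squareTableau hbeta hrect hL hm⟩
  exact Nat.card_pos

theorem LRcoeff_eq_zero_of_isEmpty {lam alpha gamma : ℕ → ℕ}
    (h : LRTableau lam alpha gamma → False) : LRcoeff lam alpha gamma = 0 := by
  have : IsEmpty (LRTableau lam alpha gamma) := ⟨h⟩
  simp [LRcoeff]

theorem LRcoeff_squareP1_eq_zero (hs : 1 ≤ s) (hbeta : IsPartition beta)
    (hrect : beta s = beta 0) (hL : beta L = 0) (hm : beta 0 + s + L ≤ m) :
    LRcoeff (complConj m beta) (complP m fun j => beta j + squareP1 s j)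
      (conjP fun j => beta j + squareP1 s j) = 0 := by
  refine LRcoeff_eq_zero_of_isEmpty fun T => ?_
  have hlam := isPartition_complConj hbeta hL (show beta 0 + L ≤ m by omega)
  have hcontent : conjP (fun j => beta j + squareP1 s j) (beta 0) = s + 1 := by
    refine conjP_eq_of_lt_iff fun r => ?_
    have h1 := hbeta.1 (Nat.zero_le r)
    have h2 := fun h : r ≤ s => apply_eq_of_le hbeta hrect h
    simp only [squareP1]
    split_ifs <;> omega
  have hle : T.countRows 1 m ≤ s := by
    have hcols : ∀ r c,
        inShape (complConj m beta) (complP m fun j => beta j + squareP1 s j) r c →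
        r < m → m - beta 0 - s ≤ c ∧ c < m - beta 0 := by
      intro r c h hr
      obtain ⟨h1, h2⟩ := h
      rw [complConj_of_lt _ hr] at h2
      simp only [complP, if_pos hr, squareP1] at h1
      have h3 := fun h : m - 1 - r ≤ s => apply_eq_of_le hbeta hrect h
      split_ifs at h1 <;> omega
    have hcard : Nat.card (Finset.Ico (m - beta 0 - s) (m - beta 0)) = s := by
      simp only [Nat.card_eq_fintype_card, Fintype.card_coe, Nat.card_Ico]
      omega
    refine le_trans ?_ hcard.le
    refine Nat.card_le_card_of_injective
      (fun p => ⟨p.1.2, Finset.mem_Ico.mpr (hcols _ _ p.2.1 p.2.2.1)⟩) ?_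
    rintro ⟨⟨r, c⟩, hs1, _, he1⟩ ⟨⟨r', c'⟩, hs2, _, he2⟩ heq
    obtain rfl : c = c' := congrArg Subtype.val heq
    simp only at hs1 he1 hs2 he2
    rcases lt_trichotomy r r' with h | rfl | h
    · have := T.col_strict r r' c h hs1 hs2
      omega
    · rfl
    · have := T.col_strict r' r c h hs2 hs1
      omega
  have h1 := T.content_le_countRows hlam (complConj_apply_add (m := m) hbeta) (beta 0)
  have h2 := T.countRows_add_le hlam 0 m (beta 0)
  rw [hcontent, show beta 0 + 1 = 0 + 1 + beta 0 by omega] at h1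
  rw [show 0 + 1 = 1 from rfl] at h1 h2
  omega

theorem LRcoeff_addRow1_eq_zero (hs : 1 ≤ s) (hbeta : IsPartition beta)
    (hrect : beta s = beta 0) (hL : beta L = 0) (hm : beta 0 + s + L ≤ m) :
    LRcoeff (complConj m beta) (complP m (addRow1 fun j => beta j + squareP s j))
      (conjP (addRow1 fun j => beta j + squareP s j)) = 0 := by
  refine LRcoeff_eq_zero_of_isEmpty fun T => ?_
  have hlam := isPartition_complConj hbeta hL (show beta 0 + L ≤ m by omega)
  have hcontent : conjP (addRow1 fun j => beta j + squareP s j) (beta 0 + s) = 1 := by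
    refine conjP_eq_of_lt_iff fun r => ?_
    have h1 := hbeta.1 (Nat.zero_le r)
    simp only [addRow1, squareP]
    split_ifs <;> omega
  have hzero : T.countRows 1 (m - s) = 0 := by
    have : IsEmpty {p : ℕ × ℕ // inShape (complConj m beta)
        (complP m (addRow1 fun j => beta j + squareP s j)) p.1 p.2 ∧
        p.1 < m - s ∧ T.entry p.1 p.2 = 1} := by
      refine ⟨?_⟩
      rintro ⟨⟨r, c⟩, ⟨h1, h2⟩, hr, -⟩
      simp only at h1 h2 hr
      rw [complConj_of_lt _ (by omega)] at h2
      simp only [complP, addRow1, squareP] at h1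
      rw [if_pos (by omega), if_neg (by omega), if_neg (by omega)] at h1
      omega
    exact Nat.card_of_isEmpty
  have h1 := T.content_le_countRows hlam (complConj_apply_add (m := m) hbeta) (beta 0 + s)
  have h2 := T.countRows_add_le hlam 0 (m - s) (beta 0 + s)
  rw [hcontent, show beta 0 + s + 1 = 0 + 1 + (beta 0 + s) by omega,
    show m + beta 0 = m - s + (beta 0 + s) by omega] at h1
  rw [show 0 + 1 = 1 from rfl] at h1 h2
  omega

end Square

/-- If `μ ⊇ β + (s^s)` has a vanishing LR coefficient at every `(β^{c,m}, β')`, then `μ` does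
not cover `β + (s^s)`. -/
theorem not_covers_of_LRcoeff_eq_zero {s : ℕ} {beta mu : ℕ → ℕ} (hs : 1 ≤ s)
    (hbeta : IsPartition beta) (hrect : beta s = beta 0) (hmu : IsPartition mu)
    (hsub : subP (fun j => beta j + squareP s j) mu)
    (hzero : ∀ m L, beta L = 0 → beta 0 + s + L ≤ m →
      LRcoeff (complConj m beta) (complP m mu) (conjP mu) = 0) :
    ¬ Covers mu (fun j => beta j + squareP s j) := by
  intro h
  have h0 := hsub 0
  have h1 := hsub (plen mu)
  rw [isPartition_apply_plen hmu] at h1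
  simp only [squareP, if_pos (show 0 < s from hs)] at h0 h1
  have hL : beta (plen mu) = 0 := by omega
  have hm : beta 0 + s + plen mu ≤ mu 0 + plen mu := by omega
  have h2 := h _ le_rfl (complConj (mu 0 + plen mu) beta)
    (isPartition_complConj hbeta hL (by omega))
  rw [hzero _ _ hL hm] at h2
  have h3 := LRcoeff_square_pos hbeta hrect hL hm
  omega

theorem not_covers_add_squareP1 {s : ℕ} {beta : ℕ → ℕ} (hs : 1 ≤ s)
    (hbeta : IsPartition beta) (hrect : beta s = beta 0) :
    ¬ Covers (fun j => beta j + squareP1 s j) (fun j => beta j + squareP s j) := by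
  refine not_covers_of_LRcoeff_eq_zero hs hbeta hrect ⟨?_, ?_⟩ ?_
    fun m L hL hm => LRcoeff_squareP1_eq_zero hs hbeta hrect hL hm
  · intro a b hab
    have := hbeta.1 hab
    simp only [squareP1]
    split_ifs <;> omega
  · obtain ⟨N, hN⟩ := hbeta.2
    have := hbeta.1 (Nat.le_add_right N (s + 1))
    refine ⟨N + (s + 1), ?_⟩
    simp only [squareP1]
    split_ifs <;> omega
  · intro j
    simp only [squareP, squareP1]
    split_ifs <;> omega

theorem not_covers_addRow1_add_squareP {s : ℕ} {beta : ℕ → ℕ} (hs : 1 ≤ s)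
    (hbeta : IsPartition beta) (hrect : beta s = beta 0) :
    ¬ Covers (addRow1 fun j => beta j + squareP s j) (fun j => beta j + squareP s j) := by
  refine not_covers_of_LRcoeff_eq_zero hs hbeta hrect ⟨?_, ?_⟩ ?_
    fun m L hL hm => LRcoeff_addRow1_eq_zero hs hbeta hrect hL hm
  · intro a b hab
    have := hbeta.1 hab
    have := hbeta.1 (Nat.zero_le b)
    simp only [addRow1, squareP]
    split_ifs <;> omega
  · obtain ⟨N, hN⟩ := hbeta.2
    have := hbeta.1 (Nat.le_add_right N (s + 1))
    refine ⟨N + (s + 1), ?_⟩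
    simp only [addRow1, squareP]
    split_ifs <;> omega
  · intro j
    by_cases hj : j = 0
    · subst hj
      simp [addRow1]
    · simp [addRow1, hj]

/-- The only partitions covering the square `(s^s)` in Young's lattice are `(s^s, 1)` and
`(s^s) + (1)`. -/
theorem eq_squareP1_or_eq_addRow1 {s : ℕ} {mu : ℕ → ℕ} (hs : 1 ≤ s) (hmu : IsPartition mu)
    (hsub : subP (squareP s) mu) (hsize : psize mu = s * s + 1) :
    mu = squareP1 s ∨ mu = addRow1 (squareP s) := by
  have hlen : s ≤ plen mu := by
    by_contra! h
    have h1 := hsub (plen mu)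
    rw [isPartition_apply_plen hmu, squareP, if_pos h] at h1
    omega
  have hvanish : ∀ j, plen mu ≤ j → mu j = 0 := by
    intro j hj
    have := hmu.1 hj
    rw [isPartition_apply_plen hmu] at this
    omega
  have hsq : ∑ j ∈ Finset.range (plen mu), squareP s j = s * s := by
    rw [← Finset.sum_subset (Finset.range_subset_range.mpr hlen)]
    · rw [Finset.sum_congr rfl (g := fun _ => s) fun j hj => by
        rw [squareP, if_pos (Finset.mem_range.mp hj)]]
      simp
    · intro j _ hj
      exact if_neg (by simpa using hj)
  have hexcess : ∑ j ∈ Finset.range (plen mu), (mu j - squareP s j) = 1 := by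
    have : ∑ j ∈ Finset.range (plen mu), (mu j - squareP s j) +
        ∑ j ∈ Finset.range (plen mu), squareP s j = psize mu := by
      rw [← Finset.sum_add_distrib]
      exact Finset.sum_congr rfl fun j _ => Nat.sub_add_cancel (hsub j)
    omega
  obtain ⟨a, ha, hapos⟩ : ∃ a ∈ Finset.range (plen mu), 0 < mu a - squareP s a := by
    by_contra! h
    rw [Finset.sum_eq_zero fun j hj => Nat.le_zero.mp (h j hj)] at hexcess
    omega
  have hle : ∀ a b, a ≠ b → (mu a - squareP s a) + (mu b - squareP s b) ≤ 1 := by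
    intro a b hab
    rcases lt_or_ge a (plen mu) with h1 | h1
    · rcases lt_or_ge b (plen mu) with h2 | h2
      · rw [← hexcess, ← Finset.sum_pair (f := fun j => mu j - squareP s j) hab]
        exact Finset.sum_le_sum_of_subset (by
          intro x hx
          simp only [Finset.mem_insert, Finset.mem_singleton] at hx
          rcases hx with rfl | rfl <;> simpa)
      · rw [hvanish b h2, Nat.zero_sub, add_zero, ← hexcess]
        exact Finset.single_le_sum (f := fun j => mu j - squareP s j)
          (fun _ _ => Nat.zero_le _) (Finset.mem_range.mpr h1)
    · rw [hvanish a h1, Nat.zero_sub, zero_add]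
      rcases lt_or_ge b (plen mu) with h2 | h2
      · rw [← hexcess]
        exact Finset.single_le_sum (f := fun j => mu j - squareP s j)
          (fun _ _ => Nat.zero_le _) (Finset.mem_range.mpr h2)
      · simp [hvanish b h2]
  have hunique : ∀ a, 0 < mu a - squareP s a →
      ∀ j, mu j = squareP s j + if j = a then 1 else 0 := by
    intro a ha j
    have h1 := hsub j
    by_cases hj : j = a
    · subst hj
      have h2 := hle j (j + 1) (by omega)
      rw [if_pos rfl]
      omega
    · have h2 := hle a j (Ne.symm hj)
      rw [if_neg hj]
      omega
  rcases lt_or_ge a s with has | has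
  · right
    have h0 : 0 < mu 0 - squareP s 0 := by
      have h1 := hmu.1 (Nat.zero_le a)
      simp only [squareP, if_pos has] at hapos
      simp only [squareP, if_pos (show 0 < s from hs)]
      omega
    funext j
    rw [hunique 0 h0 j]
    by_cases hj : j = 0
    · subst hj
      simp [addRow1]
    · simp [addRow1, hj]
  · left
    have h0 : 0 < mu s - squareP s s := by
      have h1 := hmu.1 has
      simp only [squareP, if_neg (show ¬ a < s by omega)] at hapos
      simp only [squareP, lt_irrefl, if_false]
      omega
    funext j
    rw [hunique s h0 j]
    simp only [squareP, squareP1]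
    split_ifs <;> omega

/-- `ν = β + (s^s)` (with `β` containing `(i^{s+1}, i, i-1, ..., 2, 1)`,
`i = β₁`) is covered neither by `β + (s^s, 1)` nor by `β + (s^s) + (1)`; in particular
the square `(s^s)` is not covered by any partition. -/
theorem beta_plus_square_not_covered (s : ℕ) (hs : 1 ≤ s) (beta : ℕ → ℕ)
    (hbeta : IsPartition beta) (hcont : subP (betaShape (beta 0) s) beta) :
    ¬ Covers (fun j => beta j + squareP1 s j) (fun j => beta j + squareP s j) ∧
    ¬ Covers (addRow1 (fun j => beta j + squareP s j)) (fun j => beta j + squareP s j) ∧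
    (∀ mu : ℕ → ℕ, IsPartition mu → subP (squareP s) mu → psize mu = s * s + 1 →
      ¬ Covers mu (squareP s)) := by
  have hrect : beta s = beta 0 := by
    have h1 := hcont s
    rw [betaShape, if_pos (Nat.le_succ s)] at h1
    exact le_antisymm (hbeta.1 (Nat.zero_le s)) h1
  refine ⟨not_covers_add_squareP1 hs hbeta hrect,
    not_covers_addRow1_add_squareP hs hbeta hrect, fun mu hmu hsub hsize => ?_⟩
  have hempty : IsPartition fun _ => 0 := ⟨antitone_const, 0, rfl⟩
  rcases eq_squareP1_or_eq_addRow1 hs hmu hsub hsize with rfl | rfl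
  · simpa using not_covers_add_squareP1 hs hempty rfl
  · simpa using not_covers_addRow1_add_squareP hs hempty rfl
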